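/- Let σ : 𝕋 → ℝ be continuous and non-constant with 0 < σ_min := inf_{x∈𝕋} σ(x) < sup_{x∈𝕋} σ(x) =: σ_max < ∞, and let u, v be a real-valued classical solution of the Goldstein–Taylor system ∂ₜu + ∂ₓv = 0, ∂ₜv + ∂ₓu = −σ(x)v on 𝕋 × (0,∞) with initial data u₀, v₀; set u_avg := (u₀)_avg. Define θ* := min(σ_min, 4/σ_max) and α* := σ_min(4 + 2√(4−σ_min²) − σ_min σ_max)/(4 + 2√(4−σ_min²) − σ_min²) if σ_min < 4/σ_max, and α* := σ_max − √(σ_max² − 4) if σ_min ≥ 4/σ_max. Then for all t ≥ 0: E_{θ*}(u(·,t) − u_avg, v(·,t)) ≤ E_{θ*}(u₀ − u_avg, v₀) · e^{−α* t}. -/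

import Mathlib

open MeasureTheory Real

/-- Average of a (2π-periodic) function over one period. -/
noncomputable def havg (h : ℝ → ℝ) : ℝ := (1 / (2 * π)) * ∫ x in (0:ℝ)..(2 * π), h x

/-- Squared L²(𝕋) norm (normalized). -/
noncomputable def nsq (h : ℝ → ℝ) : ℝ := (1 / (2 * π)) * ∫ x in (0:ℝ)..(2 * π), (h x) ^ 2

/-- The anti-derivative ∂ₓ⁻¹ f with zero average. -/
noncomputable def antider (f : ℝ → ℝ) : ℝ → ℝ := fun x =>
  (∫ y in (0:ℝ)..x, f y) - havg (fun z => ∫ y in (0:ℝ)..z, f y)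

/-- The entropy functional E_θ(f,g). -/
noncomputable def entropyE (θ : ℝ) (f g : ℝ → ℝ) : ℝ :=
  nsq f + nsq g - (θ / (2 * π)) * ∫ x in (0:ℝ)..(2 * π), antider f x * g x

theorem Continuous.memLp_restrict_Ioc {E : Type*} [NormedAddCommGroup E] {f : ℝ → E}
    (hf : Continuous f) (p : ENNReal) (a b : ℝ) : MemLp f p (volume.restrict (Set.Ioc a b)) := by
  obtain ⟨C, hC⟩ := (isCompact_Icc (a := a) (b := b)).exists_bound_of_continuousOn hf.continuousOn
  refine MemLp.of_bound hf.aestronglyMeasurable.restrict C ?_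
  filter_upwards [ae_restrict_mem measurableSet_Ioc] with x hx
  exact hC x (Set.Ioc_subset_Icc_self hx)

/-- **Wirtinger's inequality** for mean-zero functions taking equal values at `0` and `2π`. -/
theorem integral_sq_le_integral_deriv_sq {f f' : ℝ → ℝ} (hf : ∀ x, HasDerivAt f (f' x) x)
    (hf' : Continuous f') (hper : f (2 * π) = f 0) (hmean : ∫ x in (0:ℝ)..(2 * π), f x = 0) :
    ∫ x in (0:ℝ)..(2 * π), f x ^ 2 ≤ ∫ x in (0:ℝ)..(2 * π), f' x ^ 2 := by
  have hfc : Continuous f := continuous_iff_continuousAt.2 fun x => (hf x).continuousAt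
  have hab : (0:ℝ) < 2 * π := two_pi_pos
  have parseval : ∀ g : ℝ → ℝ, Continuous g →
      HasSum (fun i => ‖fourierCoeffOn hab (fun x => (g x : ℂ)) i‖ ^ 2)
        ((2 * π)⁻¹ * ∫ x in (0:ℝ)..(2 * π), g x ^ 2) := by
    intro g hg
    have h := hasSum_sq_fourierCoeffOn (f := fun x => (g x : ℂ)) hab
      ((Complex.continuous_ofReal.comp hg).memLp_restrict_Ioc 2 _ _)
    simpa using h
  have hle : (2 * π)⁻¹ * ∫ x in (0:ℝ)..(2 * π), f x ^ 2 ≤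
      (2 * π)⁻¹ * ∫ x in (0:ℝ)..(2 * π), f' x ^ 2 := by
    refine hasSum_le (fun n => ?_) (parseval f hfc) (parseval f' hf')
    rcases eq_or_ne n 0 with rfl | hn
    · have h0 : fourierCoeffOn hab (fun x => (f x : ℂ)) 0 = 0 := by
        rw [fourierCoeffOn_eq_integral]
        simp only [neg_zero, fourier_zero, one_smul]
        rw [intervalIntegral.integral_ofReal, hmean]
        simp
      rw [h0]
      simp only [norm_zero, zero_pow two_ne_zero]
      positivity
    · have h := fourierCoeffOn_of_hasDerivAt hab hn (f := fun x => (f x : ℂ))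
        (f' := fun x => (f' x : ℂ)) (fun x _ => (hf x).ofReal_comp)
        ((Complex.continuous_ofReal.comp hf').intervalIntegrable _ _)
      rw [h, hper]
      have hn1 : (1:ℝ) ≤ |(n:ℝ)| := by exact_mod_cast Int.one_le_abs hn
      gcongr
      simp only [sub_self, mul_zero, zero_sub, norm_mul, norm_neg, norm_div, norm_one,
        Complex.norm_I, Complex.ofReal_mul, Complex.ofReal_zero, sub_zero, Complex.norm_real,
        Complex.norm_ofNat, Complex.ofReal_ofNat, Complex.norm_intCast, norm_eq_abs,
        abs_of_pos pi_pos, mul_one]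
      rw [← mul_assoc]
      refine mul_le_of_le_one_left (norm_nonneg _) ?_
      rw [one_div, inv_mul_le_iff₀ (by positivity)]
      nlinarith [two_pi_pos]
  exact le_of_mul_le_mul_left hle (by positivity)

theorem hasDerivAt_intervalIntegral_of_continuousOn_Ioi {F F' : ℝ → ℝ → ℝ} {c : ℝ} {a b t : ℝ}
    (hF : Continuous (Function.uncurry F))
    (hF' : ContinuousOn (Function.uncurry F') (Set.Ioi c ×ˢ Set.univ))
    (hd : ∀ s, c < s → ∀ x, HasDerivAt (fun r => F r x) (F' s x) s) (ht : c < t) :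
    HasDerivAt (fun s => ∫ x in a..b, F s x) (∫ x in a..b, F' t x) t := by
  have hslice : ∀ s, Continuous (F s) := fun s => hF.comp (by fun_prop : Continuous fun x => (s, x))
  have hslice' : Continuous (F' t) := by
    rw [← continuousOn_univ]
    exact hF'.comp (f := fun x => (t, x)) (by fun_prop) fun x _ => ⟨ht, trivial⟩
  obtain ⟨r, hcr, hrt⟩ := exists_between ht
  have hsub : Set.Icc r (t + 1) ×ˢ Set.uIcc a b ⊆ Set.Ioi c ×ˢ Set.univ :=
    Set.prod_mono (fun s hs => hcr.trans_le hs.1) (Set.subset_univ _)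
  obtain ⟨C, hC⟩ := (isCompact_Icc.prod isCompact_uIcc).exists_bound_of_continuousOn (hF'.mono hsub)
  refine (intervalIntegral.hasDerivAt_integral_of_dominated_loc_of_deriv_le
    (s := Set.Icc r (t + 1)) (bound := fun _ => C) (Icc_mem_nhds hrt (by linarith))
    (Filter.Eventually.of_forall fun s => (hslice s).aestronglyMeasurable.restrict)
    ((hslice t).intervalIntegrable _ _) hslice'.aestronglyMeasurable.restrict
    (ae_of_all _ fun x hx s hs => hC (s, x) ⟨hs, Set.uIoc_subset_uIcc hx⟩)
    intervalIntegrable_const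
    (ae_of_all _ fun x _ s hs => hd s (hcr.trans_le hs.1) x)).2

theorem dissipation_form_nonneg {θ α M s : ℝ} (hθ₀ : 0 ≤ θ) (hθ : θ ≤ 2) (hα : α ≤ θ) (hs : θ ≤ s)
    (hsM : s ≤ M) (hM : θ ^ 2 * (M - α) ^ 2 ≤ 4 * (θ - α) * (2 * M - θ - α)) (w z : ℝ) :
    0 ≤ (θ - α) * w ^ 2 + (2 * s - θ - α) * z ^ 2 - θ * (s - α) * (w * z) := by
  have hdisc : θ ^ 2 * (s - α) ^ 2 ≤ 4 * (θ - α) * (2 * s - θ - α) := by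
    rcases hs.eq_or_lt with rfl | hs'
    · nlinarith [mul_nonneg (sq_nonneg (θ - α)) (by nlinarith : 0 ≤ 4 - θ ^ 2)]
    · have h1 : 0 ≤ (θ - α) ^ 2 * (4 - θ ^ 2) :=
        mul_nonneg (sq_nonneg _) (by nlinarith)
      have hMθ : 0 < M - θ := by linarith
      have key : (M - θ) * (4 * (θ - α) * (2 * s - θ - α) - θ ^ 2 * (s - α) ^ 2) =
          (M - s) * ((θ - α) ^ 2 * (4 - θ ^ 2)) +
          (s - θ) * (4 * (θ - α) * (2 * M - θ - α) - θ ^ 2 * (M - α) ^ 2) +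
          θ ^ 2 * ((M - s) * (s - θ) * (M - θ)) := by ring
      have : 0 ≤ (M - θ) * (4 * (θ - α) * (2 * s - θ - α) - θ ^ 2 * (s - α) ^ 2) := by
        rw [key]
        have := mul_nonneg (sub_nonneg.2 hsM) h1
        have := mul_nonneg (sub_nonneg.2 hs) (sub_nonneg.2 hM)
        have := mul_nonneg (sq_nonneg θ)
          (mul_nonneg (mul_nonneg (sub_nonneg.2 hsM) (sub_nonneg.2 hs)) hMθ.le)
        linarith
      linarith [nonneg_of_mul_nonneg_right this hMθ]
  rcases hα.eq_or_lt with rfl | hα'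
  · have hz : α * (s - α) = 0 := by
      have : (α * (s - α)) ^ 2 ≤ 0 := by nlinarith
      exact pow_eq_zero_iff two_ne_zero |>.1 (le_antisymm this (sq_nonneg _))
    rw [hz]
    nlinarith [mul_nonneg (sub_nonneg.2 hs) (sq_nonneg z)]
  · have hpos : 0 < θ - α := by linarith
    have : 0 ≤ 4 * (θ - α) * ((θ - α) * w ^ 2 + (2 * s - θ - α) * z ^ 2 - θ * (s - α) * (w * z)) := by
      have h1 := mul_nonneg (sub_nonneg.2 hdisc) (sq_nonneg z)
      have h2 := sq_nonneg (2 * (θ - α) * w - θ * (s - α) * z)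
      nlinarith
    exact nonneg_of_mul_nonneg_right this (by linarith)

/-- The weight `θ*` and the rate `α*` satisfy the constraints under which the dissipation form is
nonnegative. -/
theorem entropy_rate_admissible {m M θ α : ℝ} (hm : 0 < m) (hmM : m < M)
    (hθ : θ = min m (4 / M))
    (hα : α = if m < 4 / M then
      m * (4 + 2 * √(4 - m ^ 2) - m * M) / (4 + 2 * √(4 - m ^ 2) - m ^ 2)
      else M - √(M ^ 2 - 4)) :
    0 ≤ θ ∧ θ ≤ 2 ∧ α ≤ θ ∧ θ ≤ m ∧
      θ ^ 2 * (M - α) ^ 2 ≤ 4 * (θ - α) * (2 * M - θ - α) := by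
  have hM : 0 < M := hm.trans hmM
  split_ifs at hα with h
  · rw [min_eq_left h.le] at hθ
    subst hθ
    rw [lt_div_iff₀ hM] at h
    have hsq : θ ^ 2 < 4 := by nlinarith
    set r := √(4 - θ ^ 2) with hr
    have hr0 : 0 ≤ r := sqrt_nonneg _
    have hr2 : r ^ 2 = 4 - θ ^ 2 := sq_sqrt (by linarith)
    have hD : 0 < 4 + 2 * r - θ ^ 2 := by linarith
    have hb : θ - α = θ ^ 2 * (M - θ) / (4 + 2 * r - θ ^ 2) := by
      rw [hα]; field_simp; ring
    have ha : M - α = (4 + 2 * r) * (M - θ) / (4 + 2 * r - θ ^ 2) := by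
      rw [hα]; field_simp; ring
    refine ⟨hm.le, by nlinarith, ?_, le_rfl, ?_⟩
    · have : 0 ≤ θ - α := by
        rw [hb]; exact div_nonneg (mul_nonneg (sq_nonneg _) (by linarith)) hD.le
      linarith
    · rw [show 2 * M - θ - α = 2 * (M - α) - (θ - α) by ring, ha, hb]
      apply le_of_eq
      field_simp
      linear_combination 4 * (M - θ) ^ 2 * hr2
  · have hm4 := not_lt.1 h
    rw [min_eq_right hm4] at hθ
    have hθM : θ * M = 4 := by rw [hθ]; field_simp
    have hθm : θ ≤ m := hθ ▸ hm4
    have hθ0 : 0 ≤ θ := hθ ▸ by positivity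
    have hM2 : 2 < M := by nlinarith
    set r := √(M ^ 2 - 4) with hr
    have hr0 : 0 ≤ r := sqrt_nonneg _
    have hr2 : r ^ 2 = M ^ 2 - 4 := sq_sqrt (by nlinarith)
    refine ⟨hθ0, by nlinarith, ?_, hθm, ?_⟩
    · rw [hα]
      by_contra! hc
      nlinarith [mul_pos hM hM, sq_nonneg (θ - M)]
    · rw [hα]
      apply le_of_eq
      linear_combination (θ ^ 2 - 4) * hr2 + (θ * M - 4) * hθM

theorem continuous_antider {f : ℝ → ℝ → ℝ} (hf : Continuous (Function.uncurry f)) :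
    Continuous (Function.uncurry fun t => antider (f t)) := by
  have hP : Continuous (Function.uncurry fun t x => ∫ y in (0:ℝ)..x, f t y) :=
    intervalIntegral.continuous_parametric_primitive_of_continuous hf
  have hI : Continuous fun t => ∫ x in (0:ℝ)..(2 * π), ∫ y in (0:ℝ)..x, f t y :=
    intervalIntegral.continuous_parametric_intervalIntegral_of_continuous' hP _ _
  exact hP.sub ((continuous_const.mul hI).comp continuous_fst)

theorem hasDerivAt_antider {f : ℝ → ℝ} (hf : Continuous f) (x : ℝ) :
    HasDerivAt (antider f) (f x) x :=
  (hf.integral_hasStrictDerivAt 0 x).hasDerivAt.sub_const _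

theorem integral_antider {f : ℝ → ℝ} (hf : Continuous f) :
    ∫ x in (0:ℝ)..(2 * π), antider f x = 0 := by
  have hP : Continuous fun x => ∫ y in (0:ℝ)..x, f y :=
    continuous_iff_continuousAt.2 fun x => (hf.integral_hasStrictDerivAt 0 x).hasDerivAt.continuousAt
  simp only [antider, havg]
  rw [intervalIntegral.integral_sub (hP.intervalIntegrable _ _) intervalIntegrable_const,
    intervalIntegral.integral_const, smul_eq_mul]
  field_simp
  ring

theorem antider_two_pi {f : ℝ → ℝ} (hf : ∫ x in (0:ℝ)..(2 * π), f x = 0) :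
    antider f (2 * π) = antider f 0 := by
  simp [antider, hf]

/-- If `∂ₜf + ∂ₓg = 0`, then `∂ₜ∂ₓ⁻¹f = g_avg - g`. -/
theorem hasDerivAt_antider_time {f g g' : ℝ → ℝ → ℝ} (hf : Continuous (Function.uncurry f))
    (hg : Continuous (Function.uncurry g))
    (hg' : ContinuousOn (Function.uncurry g') (Set.Ioi 0 ×ˢ Set.univ))
    (hgx : ∀ t, 0 < t → ∀ x, HasDerivAt (g t) (g' t x) x)
    (hft : ∀ t, 0 < t → ∀ x, HasDerivAt (fun s => f s x) (-g' t x) t) {t : ℝ} (ht : 0 < t)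
    (x : ℝ) : HasDerivAt (fun s => antider (f s) x) (havg (g t) - g t x) t := by
  have hslice : ∀ s, Continuous (g s) := fun s => hg.comp (by fun_prop : Continuous fun x => (s, x))
  have hP : ∀ s, 0 < s → ∀ y,
      HasDerivAt (fun r => ∫ z in (0:ℝ)..y, f r z) (g s 0 - g s y) s := by
    intro s hs y
    have hc : Continuous (g' s) := by
      rw [← continuousOn_univ]
      exact hg'.comp (f := fun x => (s, x)) (by fun_prop) fun x _ => ⟨hs, trivial⟩
    convert hasDerivAt_intervalIntegral_of_continuousOn_Ioi (a := 0) (b := y)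
      (F' := fun r z => -g' r z) hf hg'.neg hft hs using 1
    rw [intervalIntegral.integral_neg, intervalIntegral.integral_eq_sub_of_hasDerivAt
      (fun z _ => hgx s hs z) (hc.intervalIntegrable _ _)]
    ring
  have hI := hasDerivAt_intervalIntegral_of_continuousOn_Ioi (a := 0) (b := 2 * π) (c := 0)
    (F := fun s y => ∫ z in (0:ℝ)..y, f s z) (F' := fun s y => g s 0 - g s y)
    (intervalIntegral.continuous_parametric_primitive_of_continuous hf)
    (Continuous.continuousOn
      ((hg.comp (by fun_prop : Continuous fun z : ℝ × ℝ => (z.1, (0:ℝ)))).sub hg)) hP ht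
  have h := (hP t ht x).sub (hI.const_mul (1 / (2 * π)))
  refine h.congr_deriv ?_
  rw [intervalIntegral.integral_sub intervalIntegrable_const ((hslice t).intervalIntegrable _ _),
    intervalIntegral.integral_const, havg, smul_eq_mul]
  field_simp
  ring

theorem antitoneOn_entropyE_mul_exp {σ : ℝ → ℝ} {θ α M : ℝ} {u v p q : ℝ → ℝ → ℝ}
    (hσ : Continuous σ) (hσθ : ∀ x, θ ≤ σ x) (hσM : ∀ x, σ x ≤ M)
    (hθ₀ : 0 ≤ θ) (hθ : θ ≤ 2) (hα : α ≤ θ)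
    (hM : θ ^ 2 * (M - α) ^ 2 ≤ 4 * (θ - α) * (2 * M - θ - α))
    (hu : Continuous (Function.uncurry u)) (hv : Continuous (Function.uncurry v))
    (hp : ContinuousOn (Function.uncurry p) (Set.Ioi 0 ×ˢ Set.univ))
    (hq : ContinuousOn (Function.uncurry q) (Set.Ioi 0 ×ˢ Set.univ))
    (hup : ∀ t, u t (2 * π) = u t 0) (hvp : ∀ t, v t (2 * π) = v t 0)
    (hux : ∀ t, 0 < t → ∀ x, HasDerivAt (u t) (p t x) x)
    (hvx : ∀ t, 0 < t → ∀ x, HasDerivAt (v t) (q t x) x)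
    (hut : ∀ t, 0 < t → ∀ x, HasDerivAt (fun s => u s x) (-q t x) t)
    (hvt : ∀ t, 0 < t → ∀ x, HasDerivAt (fun s => v s x) (-p t x - σ x * v t x) t)
    (hmean : ∀ t, 0 < t → ∫ x in (0:ℝ)..(2 * π), u t x = 0) :
    AntitoneOn (fun t => entropyE θ (u t) (v t) * exp (α * t)) (Set.Ici 0) := by
  have hA := continuous_antider hu
  set A : ℝ → ℝ → ℝ := fun t => antider (u t)
  have hu2 : Continuous (Function.uncurry fun t x => u t x ^ 2) := hu.pow 2
  have hv2 : Continuous (Function.uncurry fun t x => v t x ^ 2) := hv.pow 2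
  have hcont : Continuous fun t => entropyE θ (u t) (v t) := by
    have h1 := intervalIntegral.continuous_parametric_intervalIntegral_of_continuous'
      (μ := volume) hu2 0 (2 * π)
    have h2 := intervalIntegral.continuous_parametric_intervalIntegral_of_continuous'
      (μ := volume) hv2 0 (2 * π)
    have h3 := intervalIntegral.continuous_parametric_intervalIntegral_of_continuous'
      (μ := volume) (f := fun t x => A t x * v t x) (hA.mul hv) 0 (2 * π)
    exact ((continuous_const.mul h1).add (continuous_const.mul h2)).sub (continuous_const.mul h3)
  have hderiv : ∀ t, 0 < t → ∃ D, HasDerivAt (fun s => entropyE θ (u s) (v s)) D t ∧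
      D + α * entropyE θ (u t) (v t) ≤ 0 := by
    intro t ht
    have hm := hmean t ht
    have hsl : ∀ {f : ℝ → ℝ → ℝ}, Continuous (Function.uncurry f) → Continuous (f t) :=
      fun hf => hf.comp (by fun_prop : Continuous fun x => (t, x))
    have hsl' : ∀ {f : ℝ → ℝ → ℝ}, ContinuousOn (Function.uncurry f) (Set.Ioi 0 ×ˢ Set.univ) →
        Continuous (f t) := fun hf => by
      rw [← continuousOn_univ]
      exact hf.comp (f := fun x => (t, x)) (by fun_prop) fun x _ => ⟨ht, trivial⟩
    have cu := hsl hu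
    have cv := hsl hv
    have cA := hsl hA
    have cp := hsl' hp
    have cq := hsl' hq
    have hσ2 : Continuous fun z : ℝ × ℝ => σ z.2 := hσ.comp continuous_snd
    have cavg : Continuous fun s => havg (v s) := continuous_const.mul
      (intervalIntegral.continuous_parametric_intervalIntegral_of_continuous' hv 0 (2 * π))
    have d1 := hasDerivAt_intervalIntegral_of_continuousOn_Ioi (a := 0) (b := 2 * π) (c := 0)
      (F := fun s x => u s x ^ 2) (F' := fun s x => 2 * (u s x * -q s x)) hu2
      (continuousOn_const.mul (hu.continuousOn.mul hq.neg))
      (fun s hs x => ((hut s hs x).pow 2).congr_deriv (by ring)) ht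
    have d2 := hasDerivAt_intervalIntegral_of_continuousOn_Ioi (a := 0) (b := 2 * π) (c := 0)
      (F := fun s x => v s x ^ 2) (F' := fun s x => 2 * (v s x * (-p s x - σ x * v s x)))
      hv2
      (continuousOn_const.mul (hv.continuousOn.mul (hp.neg.sub (hσ2.mul hv).continuousOn)))
      (fun s hs x => ((hvt s hs x).pow 2).congr_deriv (by ring)) ht
    have d3 := hasDerivAt_intervalIntegral_of_continuousOn_Ioi (a := 0) (b := 2 * π) (c := 0)
      (F := fun s x => A s x * v s x)
      (F' := fun s x => (havg (v s) - v s x) * v s x + A s x * (-p s x - σ x * v s x))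
      (hA.mul hv)
      (((((cavg.comp continuous_fst).sub hv).mul hv).continuousOn).add
        (hA.continuousOn.mul (hp.neg.sub (hσ2.mul hv).continuousOn)))
      (fun s hs x => (hasDerivAt_antider_time hu hv hq hvx hut hs x).mul (hvt s hs x)) ht
    refine ⟨_, ((d1.const_mul _).add (d2.const_mul _)).sub (d3.const_mul _), ?_⟩
    have ii : ∀ {f : ℝ → ℝ}, Continuous f → IntervalIntegrable f volume 0 (2 * π) :=
      fun hf => hf.intervalIntegrable _ _
    have e1 : ∫ x in (0:ℝ)..(2 * π), 2 * (u t x * -q t x) =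
        -2 * ∫ x in (0:ℝ)..(2 * π), u t x * q t x := by
      rw [← intervalIntegral.integral_const_mul]
      congr 1 with x
      ring
    have e2 : ∫ x in (0:ℝ)..(2 * π), 2 * (v t x * (-p t x - σ x * v t x)) =
        -2 * (∫ x in (0:ℝ)..(2 * π), v t x * p t x) -
          2 * ∫ x in (0:ℝ)..(2 * π), σ x * v t x ^ 2 := by
      rw [← intervalIntegral.integral_const_mul, ← intervalIntegral.integral_const_mul,
        ← intervalIntegral.integral_sub (ii (by fun_prop)) (ii (by fun_prop))]
      congr 1 with x
      ring
    have e3 : ∫ x in (0:ℝ)..(2 * π),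
          ((havg (v t) - v t x) * v t x + A t x * (-p t x - σ x * v t x)) =
        havg (v t) * (∫ x in (0:ℝ)..(2 * π), v t x) - (∫ x in (0:ℝ)..(2 * π), v t x ^ 2) -
          (∫ x in (0:ℝ)..(2 * π), A t x * p t x) -
          ∫ x in (0:ℝ)..(2 * π), σ x * (A t x * v t x) := by
      rw [← intervalIntegral.integral_const_mul,
        ← intervalIntegral.integral_sub (ii (by fun_prop)) (ii (by fun_prop)),
        ← intervalIntegral.integral_sub (ii (by fun_prop)) (ii (by fun_prop)),
        ← intervalIntegral.integral_sub (ii (by fun_prop)) (ii (by fun_prop))]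
      congr 1 with x
      ring
    have hAx : ∀ x, HasDerivAt (A t) (u t x) x := hasDerivAt_antider cu
    have hAp : A t (2 * π) = A t 0 := antider_two_pi hm
    have b1 : (∫ x in (0:ℝ)..(2 * π), u t x * q t x) +
        ∫ x in (0:ℝ)..(2 * π), v t x * p t x = 0 := by
      rw [← intervalIntegral.integral_add (ii (by fun_prop)) (ii (by fun_prop)),
        intervalIntegral.integral_eq_sub_of_hasDerivAt (f := fun x => u t x * v t x)
          (fun x _ => ((hux t ht x).mul (hvx t ht x)).congr_deriv (by ring)) (ii (by fun_prop)),
        hup, hvp, sub_self]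
    have b2 : (∫ x in (0:ℝ)..(2 * π), u t x ^ 2) +
        ∫ x in (0:ℝ)..(2 * π), A t x * p t x = 0 := by
      rw [← intervalIntegral.integral_add (ii (by fun_prop)) (ii (by fun_prop)),
        intervalIntegral.integral_eq_sub_of_hasDerivAt (f := fun x => A t x * u t x)
          (fun x _ => ((hAx x).mul (hux t ht x)).congr_deriv (by ring)) (ii (by fun_prop)),
        hup, hAp, sub_self]
    have wirtinger : ∫ x in (0:ℝ)..(2 * π), A t x ^ 2 ≤ ∫ x in (0:ℝ)..(2 * π), u t x ^ 2 :=
      integral_sq_le_integral_deriv_sq hAx cu hAp (integral_antider cu)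
    have quad : 0 ≤ (θ - α) * (∫ x in (0:ℝ)..(2 * π), A t x ^ 2) +
        2 * (∫ x in (0:ℝ)..(2 * π), σ x * v t x ^ 2) -
        (θ + α) * (∫ x in (0:ℝ)..(2 * π), v t x ^ 2) -
        θ * (∫ x in (0:ℝ)..(2 * π), σ x * (A t x * v t x)) +
        θ * α * ∫ x in (0:ℝ)..(2 * π), A t x * v t x := by
      simp only [← intervalIntegral.integral_const_mul]
      rw [← intervalIntegral.integral_add (ii (by fun_prop)) (ii (by fun_prop)),
        ← intervalIntegral.integral_sub (ii (by fun_prop)) (ii (by fun_prop)),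
        ← intervalIntegral.integral_sub (ii (by fun_prop)) (ii (by fun_prop)),
        ← intervalIntegral.integral_add (ii (by fun_prop)) (ii (by fun_prop))]
      refine intervalIntegral.integral_nonneg two_pi_pos.le fun x _ => ?_
      have := dissipation_form_nonneg hθ₀ hθ hα (hσθ x) (hσM x) hM (A t x) (v t x)
      linarith
    rw [e1, e2, e3, entropyE, nsq, nsq, havg]
    have hc : 0 < 1 / (2 * π) := by positivity
    have hw := mul_le_mul_of_nonneg_left wirtinger (sub_nonneg.2 hα)
    have hav := mul_nonneg hθ₀ (mul_nonneg hc.le (sq_nonneg (∫ x in (0:ℝ)..(2 * π), v t x)))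
    rw [div_eq_mul_one_div θ]
    have hneg := mul_nonneg hc.le (add_nonneg (add_nonneg quad (sub_nonneg.2 hw)) hav)
    change _ + α * (_ + _ - θ * (1 / (2 * π)) * ∫ x in (0:ℝ)..(2 * π), A t x * v t x) ≤ 0
    generalize 1 / (2 * π) = c at *
    linear_combination hneg - 2 * c * b1 + c * θ * b2
  refine antitoneOn_of_deriv_nonpos (convex_Ici 0) (by fun_prop) ?_ ?_
  · intro t ht
    rw [interior_Ici] at ht
    obtain ⟨D, hD, -⟩ := hderiv t ht
    exact (hD.mul ((hasDerivAt_id t).const_mul α).exp).differentiableAt.differentiableWithinAt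
  · intro t ht
    rw [interior_Ici] at ht
    obtain ⟨D, hD, hle⟩ := hderiv t ht
    have h := hD.mul ((hasDerivAt_id t).const_mul α).exp
    rw [show (fun t => entropyE θ (u t) (v t) * exp (α * t)) =
      (fun s => entropyE θ (u s) (v s)) * fun s => exp (α * id s) from rfl, h.deriv]
    have := mul_nonpos_of_nonpos_of_nonneg hle (exp_pos (α * t)).le
    simp only [id]
    linarith

theorem integral_eq_zero_of_conservation_law {f g g' : ℝ → ℝ → ℝ}
    (hf : Continuous (Function.uncurry f))
    (hg' : ContinuousOn (Function.uncurry g') (Set.Ioi 0 ×ˢ Set.univ))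
    (hgp : ∀ t, g t (2 * π) = g t 0)
    (hgx : ∀ t, 0 < t → ∀ x, HasDerivAt (g t) (g' t x) x)
    (hft : ∀ t, 0 < t → ∀ x, HasDerivAt (fun s => f s x) (-g' t x) t)
    (h0 : ∫ x in (0:ℝ)..(2 * π), f 0 x = 0) {t : ℝ} (ht : 0 < t) :
    ∫ x in (0:ℝ)..(2 * π), f t x = 0 := by
  have hd : ∀ s ∈ Set.Ioo 0 t,
      HasDerivAt (fun r => ∫ x in (0:ℝ)..(2 * π), f r x) 0 s := by
    intro s hs
    have hc : Continuous (g' s) := by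
      rw [← continuousOn_univ]
      exact hg'.comp (f := fun x => (s, x)) (by fun_prop) fun x _ => ⟨hs.1, trivial⟩
    convert hasDerivAt_intervalIntegral_of_continuousOn_Ioi (a := 0) (b := 2 * π)
      (F' := fun r z => -g' r z) hf hg'.neg hft hs.1 using 1
    rw [intervalIntegral.integral_neg, intervalIntegral.integral_eq_sub_of_hasDerivAt
      (fun z _ => hgx s hs.1 z) (hc.intervalIntegrable _ _), hgp]
    ring
  obtain ⟨s, -, hs⟩ := exists_hasDerivAt_eq_slope _ (fun _ => 0) ht
    (intervalIntegral.continuous_parametric_intervalIntegral_of_continuous' hf 0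
      (2 * π)).continuousOn hd
  rw [h0, eq_div_iff (by simpa using ht.ne')] at hs
  linarith

theorem ContDiffOn.continuous_uncurry_max {f : ℝ → ℝ → ℝ}
    (hf : ContDiffOn ℝ 1 (Function.uncurry f) (Set.Ici (0:ℝ) ×ˢ Set.univ)) :
    Continuous (Function.uncurry fun t => f (max t 0)) := by
  rw [← continuousOn_univ]
  exact hf.continuousOn.comp (f := fun z : ℝ × ℝ => (max z.1 0, z.2)) (by fun_prop)
    fun z _ => ⟨le_max_right z.1 0, trivial⟩

theorem ContDiffOn.differentiableAt_uncurry {f : ℝ → ℝ → ℝ}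
    (hf : ContDiffOn ℝ 1 (Function.uncurry f) (Set.Ici (0:ℝ) ×ˢ Set.univ)) {t : ℝ} (ht : 0 < t)
    (x : ℝ) : DifferentiableAt ℝ (Function.uncurry f) (t, x) :=
  (hf.contDiffAt (prod_mem_nhds (Ici_mem_nhds ht) Filter.univ_mem)).differentiableAt one_ne_zero

theorem ContDiffOn.hasDerivAt_space {f : ℝ → ℝ → ℝ}
    (hf : ContDiffOn ℝ 1 (Function.uncurry f) (Set.Ici (0:ℝ) ×ˢ Set.univ)) {t : ℝ} (ht : 0 < t)
    (x : ℝ) : HasDerivAt (f t) (fderiv ℝ (Function.uncurry f) (t, x) (0, 1)) x :=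
  (hf.differentiableAt_uncurry ht x).hasFDerivAt.comp_hasDerivAt x
    ((hasDerivAt_const x t).prodMk (hasDerivAt_id x))

theorem ContDiffOn.hasDerivAt_time {f : ℝ → ℝ → ℝ}
    (hf : ContDiffOn ℝ 1 (Function.uncurry f) (Set.Ici (0:ℝ) ×ˢ Set.univ)) {t : ℝ} (ht : 0 < t)
    (x : ℝ) : HasDerivAt (fun s => f (max s 0) x) (deriv (fun s => f s x) t) t := by
  have h : DifferentiableAt ℝ (fun s => f s x) t :=
    (hf.differentiableAt_uncurry ht x).comp t (f := fun s => (s, x)) (by fun_prop)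
  refine h.hasDerivAt.congr_of_eventuallyEq ?_
  filter_upwards [Ioi_mem_nhds ht] with s hs
  rw [max_eq_left (le_of_lt hs)]

theorem ContDiffOn.continuousOn_fderiv_space {f : ℝ → ℝ → ℝ}
    (hf : ContDiffOn ℝ 1 (Function.uncurry f) (Set.Ici (0:ℝ) ×ˢ Set.univ)) :
    ContinuousOn (Function.uncurry fun t x => fderiv ℝ (Function.uncurry f) (t, x) (0, 1))
      (Set.Ioi 0 ×ˢ Set.univ) :=
  ((hf.mono (Set.prod_mono Set.Ioi_subset_Ici_self subset_rfl)).continuousOn_fderiv_of_isOpen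
    (isOpen_Ioi.prod isOpen_univ) le_rfl).clm_apply continuousOn_const

/-- Theorem 1.1 (b), entropy decay for non-constant relaxation σ(x). -/
theorem gt_nonconstant_entropy_decay
    (σ : ℝ → ℝ) (hσc : Continuous σ) (hσp : Function.Periodic σ (2 * π))
    (hmin : 0 < sInf (Set.range σ))
    (hminmax : sInf (Set.range σ) < sSup (Set.range σ))
    (u v : ℝ → ℝ → ℝ) (u₀ v₀ : ℝ → ℝ)
    (huC : ContDiffOn ℝ 1 (Function.uncurry u) (Set.Ici (0:ℝ) ×ˢ Set.univ))
    (hvC : ContDiffOn ℝ 1 (Function.uncurry v) (Set.Ici (0:ℝ) ×ˢ Set.univ))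
    (hup : ∀ t, Function.Periodic (u t) (2 * π))
    (hvp : ∀ t, Function.Periodic (v t) (2 * π))
    (hpde1 : ∀ t, 0 < t → ∀ x, deriv (fun s => u s x) t + deriv (fun y => v t y) x = 0)
    (hpde2 : ∀ t, 0 < t → ∀ x,
      deriv (fun s => v s x) t + deriv (fun y => u t y) x = -σ x * v t x)
    (hu0 : ∀ x, u 0 x = u₀ x) (hv0 : ∀ x, v 0 x = v₀ x) :
    ∀ t, 0 ≤ t →
      entropyE (min (sInf (Set.range σ)) (4 / sSup (Set.range σ)))
          (fun x => u t x - havg u₀) (v t) ≤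
        entropyE (min (sInf (Set.range σ)) (4 / sSup (Set.range σ)))
            (fun x => u₀ x - havg u₀) v₀ *
          Real.exp (-(if sInf (Set.range σ) < 4 / sSup (Set.range σ) then
              sInf (Set.range σ) *
                  (4 + 2 * Real.sqrt (4 - sInf (Set.range σ) ^ 2) -
                    sInf (Set.range σ) * sSup (Set.range σ)) /
                (4 + 2 * Real.sqrt (4 - sInf (Set.range σ) ^ 2) - sInf (Set.range σ) ^ 2)
            else sSup (Set.range σ) - Real.sqrt (sSup (Set.range σ) ^ 2 - 4)) * t) := by
  obtain ⟨hθ₀, hθ2, hαθ, hθm, hM⟩ := entropy_rate_admissible hmin hminmax rfl rfl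
  set m := sInf (Set.range σ)
  set M := sSup (Set.range σ)
  set θ := min m (4 / M)
  set α := if m < 4 / M then
      m * (4 + 2 * √(4 - m ^ 2) - m * M) / (4 + 2 * √(4 - m ^ 2) - m ^ 2)
    else M - √(M ^ 2 - 4)
  have hcomp : IsCompact (Set.range σ) := hσp.compact_of_continuous two_pi_pos.ne' hσc
  have hσm : ∀ x, m ≤ σ x := fun x => csInf_le hcomp.bddBelow ⟨x, rfl⟩
  have hσM : ∀ x, σ x ≤ M := fun x => le_csSup hcomp.bddAbove ⟨x, rfl⟩
  obtain rfl : u 0 = u₀ := funext hu0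
  obtain rfl : v 0 = v₀ := funext hv0
  have hUc : Continuous (Function.uncurry fun t x => u (max t 0) x - havg (u 0)) :=
    huC.continuous_uncurry_max.sub continuous_const
  have hUt : ∀ t, 0 < t → ∀ x, HasDerivAt (fun s => u (max s 0) x - havg (u 0))
      (-fderiv ℝ (Function.uncurry v) (t, x) (0, 1)) t := fun t ht x =>
    ((huC.hasDerivAt_time ht x).sub_const _).congr_deriv (by
      rw [← (hvC.hasDerivAt_space ht x).deriv]
      linarith [hpde1 t ht x])
  have hVx : ∀ t, 0 < t → ∀ x, HasDerivAt (v (max t 0))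
      (fderiv ℝ (Function.uncurry v) (t, x) (0, 1)) x := fun t ht x => by
    rw [max_eq_left ht.le]
    exact hvC.hasDerivAt_space ht x
  have hVp : ∀ t, v (max t 0) (2 * π) = v (max t 0) 0 := fun t => by
    simpa using hvp (max t 0) 0
  have hmean0 : ∫ x in (0:ℝ)..(2 * π), (u (max 0 0) x - havg (u 0)) = 0 := by
    have hc : Continuous (u 0) := by
      simpa [Function.comp_def] using
        huC.continuous_uncurry_max.comp (by fun_prop : Continuous fun x : ℝ => ((0:ℝ), x))
    rw [max_self, intervalIntegral.integral_sub (hc.intervalIntegrable _ _)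
      intervalIntegrable_const, intervalIntegral.integral_const, havg, smul_eq_mul]
    field_simp
    ring
  have hanti := antitoneOn_entropyE_mul_exp hσc (fun x => hθm.trans (hσm x)) hσM hθ₀ hθ2 hαθ hM
    hUc hvC.continuous_uncurry_max huC.continuousOn_fderiv_space hvC.continuousOn_fderiv_space
    (fun t => by simpa using hup (max t 0) 0) hVp
    (fun t ht x => by
      rw [max_eq_left ht.le]
      exact (huC.hasDerivAt_space ht x).sub_const _)
    hVx hUt
    (fun t ht x => (hvC.hasDerivAt_time ht x).congr_deriv (by
      rw [← (huC.hasDerivAt_space ht x).deriv, max_eq_left ht.le]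
      linarith [hpde2 t ht x]))
    (fun t ht => integral_eq_zero_of_conservation_law hUc hvC.continuousOn_fderiv_space hVp hVx
      hUt hmean0 ht)
  intro t ht
  have h := hanti Set.self_mem_Ici (Set.mem_Ici.2 ht) ht
  simp only [max_self, max_eq_left ht, mul_zero, exp_zero, mul_one] at h
  rw [neg_mul, exp_neg, ← div_eq_mul_inv, le_div_iff₀ (exp_pos _)]
  exact h
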